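/- The scalar curvature of the full connection of a generalised pp-wave with purely axial torsion vanishes identically: g^{λν} Ric_{λν} = 0, where Ric_{λν} := R[Γ]^μ_{λμν}. -/

import Mathlib

noncomputable section

open scoped BigOperators

/-- Points of spacetime: ℝ⁴ with coordinates x⁰, x¹, x², x³. -/
abbrev Spacetime := Fin 4 → ℝ

/-- Partial derivative ∂_μ of a scalar function. -/
def pd (μ : Fin 4) (h : Spacetime → ℝ) : Spacetime → ℝ :=
  fun x => fderiv ℝ h x (Pi.single μ 1)

/-- The pp-metric g_{μν}: nonzero components g₀₃ = g₃₀ = 1, g₁₁ = g₂₂ = −1, g₃₃ = f. -/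
def ppMetric (f : Spacetime → ℝ) (x : Spacetime) (μ ν : Fin 4) : ℝ :=
  if μ = 0 ∧ ν = 3 then 1 else if μ = 3 ∧ ν = 0 then 1
  else if μ = 1 ∧ ν = 1 then -1 else if μ = 2 ∧ ν = 2 then -1
  else if μ = 3 ∧ ν = 3 then f x else 0

/-- The pointwise inverse metric g^{μν}: g⁰⁰ = −f, g⁰³ = g³⁰ = 1, g¹¹ = g²² = −1. -/
def ppMetricInv (f : Spacetime → ℝ) (x : Spacetime) (μ ν : Fin 4) : ℝ :=
  if μ = 0 ∧ ν = 0 then -(f x) else if μ = 0 ∧ ν = 3 then 1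
  else if μ = 3 ∧ ν = 0 then 1
  else if μ = 1 ∧ ν = 1 then -1 else if μ = 2 ∧ ν = 2 then -1 else 0

/-- Christoffel symbols {Γ}^λ_{μν} = ½ g^{λκ}(∂_μ g_{κν} + ∂_ν g_{κμ} − ∂_κ g_{μν}). -/
def christoffel (f : Spacetime → ℝ) (x : Spacetime) (l μ ν : Fin 4) : ℝ :=
  (1/2) * ∑ κ, ppMetricInv f x l κ *
    (pd μ (fun y => ppMetric f y κ ν) x + pd ν (fun y => ppMetric f y κ μ) x
      - pd κ (fun y => ppMetric f y μ ν) x)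

/-- Totally antisymmetric symbol ε with ε₀₁₂₃ = 1. -/
def eps (a b c d : Fin 4) : ℝ :=
  ((((b:ℕ):ℝ) - ((a:ℕ):ℝ)) * (((c:ℕ):ℝ) - ((a:ℕ):ℝ)) * (((d:ℕ):ℝ) - ((a:ℕ):ℝ)) *
    (((c:ℕ):ℝ) - ((b:ℕ):ℝ)) * (((d:ℕ):ℝ) - ((b:ℕ):ℝ)) * (((d:ℕ):ℝ) - ((c:ℕ):ℝ))) / 12

/-- Purely axial torsion T_{κμν} = k(x³) ε_{0κμν}. -/
def torsion (k : ℝ → ℝ) (x : Spacetime) (κ μ ν : Fin 4) : ℝ :=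
  k (x 3) * eps 0 κ μ ν

/-- Contorsion K^κ_{μν} = ½ g^{κρ} T_{ρμν}. -/
def contorsion (f : Spacetime → ℝ) (k : ℝ → ℝ) (x : Spacetime) (κ μ ν : Fin 4) : ℝ :=
  (1/2) * ∑ ρ, ppMetricInv f x κ ρ * torsion k x ρ μ ν

/-- The full connection Γ^λ_{μν} = {Γ}^λ_{μν} + K^λ_{μν}. -/
def fullConn (f : Spacetime → ℝ) (k : ℝ → ℝ) (x : Spacetime) (κ μ ν : Fin 4) : ℝ :=
  christoffel f x κ μ ν + contorsion f k x κ μ ν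

/-- Curvature R[A]^κ_{λμν} of connection coefficients A^κ_{μν}. -/
def curv (A : Spacetime → Fin 4 → Fin 4 → Fin 4 → ℝ) (x : Spacetime)
    (κ l μ ν : Fin 4) : ℝ :=
  pd μ (fun y => A y κ ν l) x - pd ν (fun y => A y κ μ l) x
    + ∑ η, (A x κ μ η * A x η ν l - A x κ ν η * A x η μ l)

/-- The parallel null vector field l^μ = (1,0,0,0). -/
def lUp : Fin 4 → ℝ := fun μ => if μ = 0 then 1 else 0

/-- The lowered vector l_μ = g_{μν} l^ν = (0,0,0,1). -/
def lCov : Fin 4 → ℝ := fun μ => if μ = 3 then 1 else 0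

/-- Ricci curvature of the full connection: Ric_{λν} = R[Γ]^μ_{λμν}. -/
def RicFull (f : Spacetime → ℝ) (k : ℝ → ℝ) (x : Spacetime) (lam ν : Fin 4) : ℝ :=
  ∑ μ, curv (fullConn f k) x μ lam μ ν

/-- Only the `33` component of the pp-metric is non-constant. -/
theorem pd_ppMetric (f : Spacetime → ℝ) (x : Spacetime) (μ a b : Fin 4) :
    pd μ (fun y => ppMetric f y a b) x = if a = 3 ∧ b = 3 then pd μ f x else 0 := by
  fin_cases a <;> fin_cases b <;> simp [ppMetric, pd]

/-- The connection coefficients of the full connection, one matrix per upper index. -/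
def fullConnMatrix (f : Spacetime → ℝ) (k : ℝ → ℝ) (x : Spacetime) :
    Fin 4 → Matrix (Fin 4) (Fin 4) ℝ
  | 0 => !![0, 0, 0, 0;
            0, 0, k (x 3) / 2, pd 1 f x / 2;
            0, -k (x 3) / 2, 0, pd 2 f x / 2;
            0, pd 1 f x / 2, pd 2 f x / 2, pd 3 f x / 2]
  | 1 => !![0, 0, 0, 0;
            0, 0, 0, 0;
            0, 0, 0, -k (x 3) / 2;
            0, 0, k (x 3) / 2, pd 1 f x / 2]
  | 2 => !![0, 0, 0, 0;
            0, 0, 0, k (x 3) / 2;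
            0, 0, 0, 0;
            0, -k (x 3) / 2, 0, pd 2 f x / 2]
  | 3 => 0

theorem fullConn_eq (f : Spacetime → ℝ) (k : ℝ → ℝ) (h0 : ∀ x, pd 0 f x = 0)
    (x : Spacetime) (κ μ ν : Fin 4) :
    fullConn f k x κ μ ν = fullConnMatrix f k x κ μ ν := by
  simp only [fullConn, christoffel, contorsion, torsion, pd_ppMetric]
  fin_cases κ <;> fin_cases μ <;> fin_cases ν <;>
    simp [Fin.sum_univ_four, fullConnMatrix, ppMetricInv, eps, h0] <;> ring

/-- the scalar curvature of the full connection vanishes identically. -/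
theorem full_scalar_curvature_vanishes
    (f : Spacetime → ℝ) (hf : ContDiff ℝ (⊤ : ℕ∞) f) (h0 : ∀ x, pd 0 f x = 0)
    (k : ℝ → ℝ) (hk : ContDiff ℝ (⊤ : ℕ∞) k) :
    ∀ x : Spacetime, ∑ lam, ∑ ν, ppMetricInv f x lam ν * RicFull f k x lam ν = 0 := by
  intro x
  have pd_zero (μ : Fin 4) : pd μ (fun _ => (0 : ℝ)) x = 0 := by simp [pd]
  simp only [RicFull, curv, fullConn_eq f k h0]
  simp [Fin.sum_univ_four, fullConnMatrix, ppMetricInv, pd_zero]
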